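/- Let S be a non-negative closed densely defined symmetric operator and a < 0. Then dom S_a ∩ dom S_a* = P_{M_a} dom S, where M_a = ran(S − aI), and the compression T_a := P_{M_a} S_a ↾ (dom S_a ∩ M_a) is a non-negative selfadjoint operator in the Hilbert space M_a, satisfying ⟨T_a h, h⟩ = ⟨Sf, f⟩ − a‖P_{N_a}f‖² ≥ 0 for h = P_{M_a}f, f ∈ dom S, and ran(T_a − aI) = M_a. -/

import Mathlib

open scoped ComplexInnerProductSpace

variable {E : Type*} [NormedAddCommGroup E] [InnerProductSpace ℂ E] [CompleteSpace E]

/-- Membership in the defect subspace `N_a = ker (S* - a)`. -/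
def memDefect (S : E →ₗ.[ℂ] E) (a : ℝ) (φ : E) : Prop :=
  ∃ hφ : φ ∈ S.adjoint.domain, S.adjoint ⟨φ, hφ⟩ = (a : ℂ) • φ

/-- Membership in `M_a = ran (S - a)`. -/
def memRan (S : E →ₗ.[ℂ] E) (a : ℝ) (y : E) : Prop :=
  ∃ g : S.domain, y = S g - (a : ℂ) • (g : E)

/-- Membership in `dom S_a = dom S ∔ N_a`, where `S_a (f + φ) = S f - a φ`. -/
def memDomSa (S : E →ₗ.[ℂ] E) (a : ℝ) (g : E) : Prop :=
  ∃ (f : S.domain) (φ : E), memDefect S a φ ∧ g = (f : E) + φ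

/-- Membership in `dom S_a*`: the functional relation defining the adjoint of `S_a`. -/
def memDomSaStar (S : E →ₗ.[ℂ] E) (a : ℝ) (h : E) : Prop :=
  ∃ w : E, ∀ (f : S.domain) (φ : E) (hφ : φ ∈ S.adjoint.domain),
    S.adjoint ⟨φ, hφ⟩ = (a : ℂ) • φ → ⟪S f - (a : ℂ) • φ, h⟫ = ⟪(f : E) + φ, w⟫

/-- `y = P_{M_a} f`: `y ∈ M_a` and `f - y ∈ N_a`. -/
def isProjRan (S : E →ₗ.[ℂ] E) (a : ℝ) (f y : E) : Prop :=
  memRan S a y ∧ memDefect S a (f - y)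

/-- The range `M_a = ran (S - a)` as a submodule. -/
def shiftRange (S : E →ₗ.[ℂ] E) (a : ℝ) : Submodule ℂ E :=
  LinearMap.range (S.toFun - (a : ℂ) • S.domain.subtype)

omit [CompleteSpace E] in
theorem memRan_iff_mem_shiftRange (S : E →ₗ.[ℂ] E) (a : ℝ) (y : E) :
    memRan S a y ↔ y ∈ shiftRange S a := by
  simp only [memRan, shiftRange, LinearMap.mem_range]
  exact exists_congr fun g => eq_comm

omit [CompleteSpace E] in
theorem sub_smul_mem_shiftRange (S : E →ₗ.[ℂ] E) (a : ℝ) (f : S.domain) :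
    S f - (a : ℂ) • (f : E) ∈ shiftRange S a :=
  ⟨f, rfl⟩

omit [CompleteSpace E] in
theorem mem_shiftRange_orthogonal_iff (S : E →ₗ.[ℂ] E) (a : ℝ) (φ : E) :
    φ ∈ (shiftRange S a)ᗮ ↔ ∀ f : S.domain, ⟪S f, φ⟫ = (a : ℂ) * ⟪(f : E), φ⟫ := by
  rw [Submodule.mem_orthogonal]
  constructor
  · intro h f
    have := h _ (sub_smul_mem_shiftRange S a f)
    rwa [inner_sub_left, inner_smul_left, Complex.conj_ofReal, sub_eq_zero] at this
  · rintro h _ ⟨f, rfl⟩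
    change ⟪S f - (a : ℂ) • (f : E), φ⟫ = 0
    rw [inner_sub_left, inner_smul_left, Complex.conj_ofReal, sub_eq_zero, h f]

theorem memDefect_iff_mem_orthogonal {S : E →ₗ.[ℂ] E} (hdense : Dense (S.domain : Set E))
    (a : ℝ) (φ : E) : memDefect S a φ ↔ φ ∈ (shiftRange S a)ᗮ := by
  rw [mem_shiftRange_orthogonal_iff]
  constructor
  · rintro ⟨hφ, h⟩ f
    have := (LinearPMap.adjoint_isFormalAdjoint hdense).symm f ⟨φ, hφ⟩
    rwa [h, inner_smul_right] at this
  · intro h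
    have key : ∀ f : S.domain, ⟪(a : ℂ) • φ, (f : E)⟫ = ⟪φ, S f⟫ := fun f => by
      rw [← inner_conj_symm φ, h f, map_mul, Complex.conj_ofReal, inner_conj_symm,
        inner_smul_left, Complex.conj_ofReal]
    exact ⟨LinearPMap.mem_adjoint_domain_of_exists φ ⟨_, key⟩,
      LinearPMap.adjoint_apply_eq hdense _ key⟩

theorem isProjRan_iff {S : E →ₗ.[ℂ] E} (hdense : Dense (S.domain : Set E)) (a : ℝ) (f y : E) :
    isProjRan S a f y ↔ y ∈ shiftRange S a ∧ f - y ∈ (shiftRange S a)ᗮ := by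
  rw [isProjRan, memRan_iff_mem_shiftRange, memDefect_iff_mem_orthogonal hdense]

omit [CompleteSpace E] in
/-- A non-negative operator satisfies `-a ‖f‖ ≤ ‖(S - a) f‖`. -/
theorem neg_mul_norm_le_norm_sub_smul {S : E →ₗ.[ℂ] E}
    (hpos : ∀ f : S.domain, 0 ≤ (⟪S f, (f : E)⟫).re) (a : ℝ) (f : S.domain) :
    -a * ‖(f : E)‖ ≤ ‖S f - (a : ℂ) • (f : E)‖ := by
  rcases (norm_nonneg (f : E)).eq_or_lt with h0 | h0
  · rw [← h0, mul_zero]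
    exact norm_nonneg _
  have h1 : (⟪S f - (a : ℂ) • (f : E), (f : E)⟫).re
      = (⟪S f, (f : E)⟫).re - a * ‖(f : E)‖ ^ 2 := by
    rw [inner_sub_left, inner_smul_left, Complex.conj_ofReal, inner_self_eq_norm_sq_to_K]
    simp [← Complex.ofReal_pow]
  have h2 : (⟪S f - (a : ℂ) • (f : E), (f : E)⟫).re
      ≤ ‖S f - (a : ℂ) • (f : E)‖ * ‖(f : E)‖ :=
    (Complex.re_le_norm _).trans (norm_inner_le_norm _ _)
  refine le_of_mul_le_mul_right ?_ h0
  nlinarith [hpos f]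

theorem isClosed_shiftRange {S : E →ₗ.[ℂ] E} (hclosed : S.IsClosed)
    (hpos : ∀ f : S.domain, 0 ≤ (⟪S f, (f : E)⟫).re) {a : ℝ} (ha : a < 0) :
    IsClosed (shiftRange S a : Set E) := by
  have : CompleteSpace S.graph := IsClosed.completeSpace_coe (hs := hclosed)
  let L : S.graph →L[ℂ] E :=
    (ContinuousLinearMap.snd ℂ E E - (a : ℂ) • ContinuousLinearMap.fst ℂ E E).comp
      S.graph.subtypeL
  have hL : AntilipschitzWith (Real.toNNReal (2 + (-a)⁻¹)) L := by
    refine AddMonoidHomClass.antilipschitz_of_bound L ?_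
    rintro ⟨⟨x, y⟩, hxy⟩
    obtain ⟨f, rfl, rfl⟩ := (LinearPMap.mem_graph_iff S).1 hxy
    have hb := neg_mul_norm_le_norm_sub_smul hpos a f
    have ha' : 0 < (-a)⁻¹ := inv_pos.2 (neg_pos.2 ha)
    rw [Real.coe_toNNReal _ (by positivity)]
    change max ‖(f : E)‖ ‖S f‖ ≤ (2 + (-a)⁻¹) * ‖S f - (a : ℂ) • (f : E)‖
    have hn := norm_nonneg (S f - (a : ℂ) • (f : E))
    have hx : ‖(f : E)‖ ≤ (-a)⁻¹ * ‖S f - (a : ℂ) • (f : E)‖ := by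
      rwa [← div_eq_inv_mul, le_div_iff₀' (neg_pos.2 ha)]
    have hy : ‖S f‖ ≤ ‖S f - (a : ℂ) • (f : E)‖ + -a * ‖(f : E)‖ := by
      calc ‖S f‖ = ‖(S f - (a : ℂ) • (f : E)) + (a : ℂ) • (f : E)‖ := by rw [sub_add_cancel]
        _ ≤ _ := norm_add_le _ _
        _ = _ := by rw [norm_smul, Complex.norm_real, Real.norm_of_nonpos ha.le]
    refine max_le ?_ ?_ <;> nlinarith
  have hrange : (shiftRange S a : Set E) = Set.range L := by
    ext y
    constructor
    · rintro ⟨f, rfl⟩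
      exact ⟨⟨(f, S f), S.mem_graph f⟩, rfl⟩
    · rintro ⟨⟨⟨x, y⟩, hxy⟩, rfl⟩
      obtain ⟨f, rfl, rfl⟩ := (LinearPMap.mem_graph_iff S).1 hxy
      exact sub_smul_mem_shiftRange S a f
  rw [hrange]
  exact hL.isClosed_range L.uniformContinuous

theorem memDomSaStar_iff {S : E →ₗ.[ℂ] E} (hdense : Dense (S.domain : Set E)) {a : ℝ}
    (hM : IsClosed (shiftRange S a : Set E)) (h : E) :
    memDomSaStar S a h ↔ ∃ w : E, (∀ f : S.domain, ⟪S f, h⟫ = ⟪(f : E), w⟫) ∧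
      w + (a : ℂ) • h ∈ shiftRange S a := by
  have : CompleteSpace (shiftRange S a) := hM.completeSpace_coe
  refine exists_congr fun w => ?_
  have hsmul : ∀ φ : E, ⟪φ, w + (a : ℂ) • h⟫ = ⟪φ, w⟫ + ⟪(a : ℂ) • φ, h⟫ := fun φ => by
    rw [inner_add_right, inner_smul_right, inner_smul_left, Complex.conj_ofReal]
  constructor
  · intro H
    have H' : ∀ (f : S.domain) (φ : E), memDefect S a φ →
        ⟪S f - (a : ℂ) • φ, h⟫ = ⟪(f : E) + φ, w⟫ := fun f φ ⟨hφ, hφ'⟩ => H f φ hφ hφ'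
    simp only [memDefect_iff_mem_orthogonal hdense] at H'
    refine ⟨fun f => by simpa using H' f 0 (zero_mem _), ?_⟩
    rw [← (shiftRange S a).orthogonal_orthogonal, Submodule.mem_orthogonal]
    intro φ hφ
    have := H' 0 φ hφ
    simp only [LinearPMap.map_zero, zero_sub, inner_neg_left, ZeroMemClass.coe_zero,
      zero_add] at this
    rw [hsmul, ← this, neg_add_cancel]
  · rintro ⟨h1, h2⟩ f φ hφ hφ'
    have hφM := (memDefect_iff_mem_orthogonal hdense a φ).1 ⟨hφ, hφ'⟩
    have := Submodule.inner_left_of_mem_orthogonal h2 hφM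
    rw [hsmul] at this
    rw [inner_sub_left, inner_add_left, h1 f]
    linear_combination -this

omit [CompleteSpace E] in
/-- `P_{N_a} S f = a P_{N_a} f`, expressed through projections onto `M_a`. -/
theorem sub_proj_eq_smul_sub_proj {S : E →ₗ.[ℂ] E} {a : ℝ} (f : S.domain) {y sy : E}
    (hy : y ∈ shiftRange S a) (hfy : (f : E) - y ∈ (shiftRange S a)ᗮ)
    (hsy : sy ∈ shiftRange S a) (hsfy : S f - sy ∈ (shiftRange S a)ᗮ) :
    S f - sy = (a : ℂ) • ((f : E) - y) := by
  rw [← sub_eq_zero]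
  refine (Submodule.mem_bot ℂ).1 ((shiftRange S a).inf_orthogonal_eq_bot ▸ ⟨?_, ?_⟩)
  · have : S f - sy - (a : ℂ) • ((f : E) - y)
        = (S f - (a : ℂ) • (f : E)) - sy + (a : ℂ) • y := by module
    rw [this]
    exact add_mem (sub_mem (sub_smul_mem_shiftRange S a f) hsy) (Submodule.smul_mem _ _ hy)
  · exact sub_mem hsfy (Submodule.smul_mem _ _ hfy)

omit [CompleteSpace E] in
/-- The inner product of compressions: `⟪P_M S f, P_M g⟫ = ⟪S f, g⟫ - a ⟪P_N f, P_N g⟫`. -/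
theorem inner_proj_eq {S : E →ₗ.[ℂ] E} {a : ℝ} (f : S.domain) {g yf sf yg : E}
    (hyf : yf ∈ shiftRange S a) (hfyf : (f : E) - yf ∈ (shiftRange S a)ᗮ)
    (hsf : sf ∈ shiftRange S a) (hsfsf : S f - sf ∈ (shiftRange S a)ᗮ)
    (hyg : yg ∈ shiftRange S a) (hgyg : g - yg ∈ (shiftRange S a)ᗮ) :
    ⟪sf, yg⟫ = ⟪S f, g⟫ - (a : ℂ) * ⟪(f : E) - yf, g - yg⟫ := by
  have h1 := sub_proj_eq_smul_sub_proj f hyf hfyf hsf hsfsf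
  have h2 : ⟪S f - sf, g - yg⟫ = (a : ℂ) * ⟪(f : E) - yf, g - yg⟫ := by
    rw [h1, inner_smul_left, Complex.conj_ofReal]
  have h3 := Submodule.inner_left_of_mem_orthogonal hyg hsfsf
  have h4 := Submodule.inner_right_of_mem_orthogonal hsf hgyg
  rw [← h2]
  simp only [inner_sub_left, inner_sub_right] at h3 h4 ⊢
  linear_combination -h3 - h4

/-- Let `S` be a non-negative closed densely defined symmetric operator and
`a < 0`.  Then `dom S_a ∩ dom S_a* = P_{M_a} dom S = dom S_a ∩ M_a = dom S_a* ∩ M_a`, where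
`M_a = ran(S − a)`; the compression `T_a = P_{M_a} S_a ↾ (dom S_a ∩ M_a)`, acting as
`T_a (P_{M_a} f) = P_{M_a} S f`, is a non-negative selfadjoint operator in the Hilbert space
`M_a` (it is symmetric, non-negative with `⟪T_a h, h⟫ = ⟪S f, f⟫ − a ‖P_{N_a} f‖² ≥ 0` for
`h = P_{M_a} f`, and `ran (T_a − a) = M_a`). -/
theorem compression_selfadjoint_nonneg
    (S : E →ₗ.[ℂ] E)
    (hdense : Dense (S.domain : Set E))
    (hclosed : S.IsClosed)
    (hsymm : ∀ f g : S.domain, ⟪S f, (g : E)⟫ = ⟪(f : E), S g⟫)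
    (hpos : ∀ f : S.domain, 0 ≤ (⟪S f, (f : E)⟫).re)
    (a : ℝ) (ha : a < 0) :
    -- `dom S_a ∩ dom S_a* = P_{M_a} dom S`
    ({g : E | memDomSa S a g} ∩ {h : E | memDomSaStar S a h}
        = {y : E | ∃ f : S.domain, isProjRan S a (f : E) y}) ∧
    -- `… = dom S_a ∩ M_a`
    ({g : E | memDomSa S a g} ∩ {y : E | memRan S a y}
        = {y : E | ∃ f : S.domain, isProjRan S a (f : E) y}) ∧
    -- `… = dom S_a* ∩ M_a`
    ({h : E | memDomSaStar S a h} ∩ {y : E | memRan S a y}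
        = {y : E | ∃ f : S.domain, isProjRan S a (f : E) y}) ∧
    -- `T_a` is symmetric in `M_a`
    (∀ (f g : S.domain) (yf sf yg sg : E),
      isProjRan S a (f : E) yf → isProjRan S a (S f) sf →
      isProjRan S a (g : E) yg → isProjRan S a (S g) sg →
      ⟪sf, yg⟫ = ⟪yf, sg⟫) ∧
    -- `⟪T_a h, h⟫ = ⟪S f, f⟫ − a ‖P_{N_a} f‖² ≥ 0` for `h = P_{M_a} f`
    (∀ (f : S.domain) (y sy : E),
      isProjRan S a (f : E) y → isProjRan S a (S f) sy →
      ⟪sy, y⟫ = ⟪S f, (f : E)⟫ - ((a * ‖(f : E) - y‖ ^ 2 : ℝ) : ℂ) ∧ 0 ≤ (⟪sy, y⟫).re) ∧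
    -- `ran (T_a − a) = M_a`
    (∀ y : E, memRan S a y → ∃ (f : S.domain) (h sh : E),
      isProjRan S a (f : E) h ∧ isProjRan S a (S f) sh ∧ sh - (a : ℂ) • h = y) := by
  have hM := isClosed_shiftRange hclosed hpos ha
  have : CompleteSpace (shiftRange S a) := hM.completeSpace_coe
  have h2a : (2 * (a : ℂ)) ≠ 0 := by simpa using ha.ne
  have hproj : ∀ x : E, ∃ y ∈ shiftRange S a, x - y ∈ (shiftRange S a)ᗮ := fun x =>
    ⟨(shiftRange S a).starProjection x, Submodule.starProjection_apply_mem _ _,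
      Submodule.sub_starProjection_mem_orthogonal x⟩
  have hdom : ∀ g : E, memDomSa S a g ↔
      ∃ f : S.domain, g - (f : E) ∈ (shiftRange S a)ᗮ := fun g => by
    simp only [memDomSa, memDefect_iff_mem_orthogonal hdense]
    refine exists_congr fun f => ⟨?_, fun h => ⟨_, h, by abel⟩⟩
    rintro ⟨φ, hφ, rfl⟩
    rwa [add_sub_cancel_left]
  have hneg : ∀ x y : E, x - y ∈ (shiftRange S a)ᗮ ↔ y - x ∈ (shiftRange S a)ᗮ :=
    fun x y => by rw [← neg_sub, neg_mem_iff]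
  have hadj : ∀ (f : S.domain) (g : E), g - (f : E) ∈ (shiftRange S a)ᗮ → ∀ k : S.domain,
      ⟪S k, g⟫ = ⟪(k : E), S f + (a : ℂ) • (g - (f : E))⟫ := fun f g hg k => by
    have := (mem_shiftRange_orthogonal_iff S a _).1 hg k
    rw [inner_add_right, inner_smul_right, ← this, ← hsymm, inner_sub_right]
    ring
  have hshift : ∀ (f : S.domain) (g : E),
      S f + (a : ℂ) • (g - (f : E)) + (a : ℂ) • g ∈ shiftRange S a ↔ g ∈ shiftRange S a :=
    fun f g => by
      have : S f + (a : ℂ) • (g - (f : E)) + (a : ℂ) • g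
          = (2 * (a : ℂ)) • g + (S f - (a : ℂ) • (f : E)) := by module
      rw [this, Submodule.add_mem_iff_left _ (sub_smul_mem_shiftRange S a f),
        Submodule.smul_mem_iff _ h2a]
  simp only [isProjRan_iff hdense, memRan_iff_mem_shiftRange, hdom, memDomSaStar_iff hdense hM]
  refine ⟨?_, ?_, ?_, ?_, ?_, ?_⟩
  · ext g
    constructor
    · rintro ⟨⟨f, hf⟩, w, hw, hwM⟩
      have hwf : w = S f + (a : ℂ) • (g - (f : E)) :=
        hdense.eq_of_inner_right ℂ fun k hk => by
          rw [← hw ⟨k, hk⟩, ← hadj f g hf ⟨k, hk⟩]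
      exact ⟨f, (hshift f g).1 (hwf ▸ hwM), (hneg _ _).1 hf⟩
    · rintro ⟨f, hg, hf⟩
      rw [hneg] at hf
      exact ⟨⟨f, hf⟩, _, hadj f g hf, (hshift f g).2 hg⟩
  · ext g
    constructor
    · rintro ⟨⟨f, hf⟩, hg⟩
      exact ⟨f, hg, (hneg _ _).1 hf⟩
    · rintro ⟨f, hg, hf⟩
      exact ⟨⟨f, (hneg _ _).1 hf⟩, hg⟩
  · ext h
    constructor
    · rintro ⟨⟨w, hw, hwM⟩, hh⟩
      have hmem : w - (a : ℂ) • h ∈ shiftRange S a := by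
        have : w - (a : ℂ) • h = (w + (a : ℂ) • h) - (2 * (a : ℂ)) • h := by module
        rw [this]
        exact sub_mem hwM (Submodule.smul_mem _ _ hh)
      obtain ⟨g, hg⟩ := (memRan_iff_mem_shiftRange S a _).2 hmem
      refine ⟨g, hh, (hneg _ _).1 ((mem_shiftRange_orthogonal_iff S a _).2 fun k => ?_)⟩
      have := congrArg (fun x => ⟪(k : E), x⟫) hg
      simp only [inner_sub_right, inner_smul_right] at this ⊢
      rw [hw, hsymm]
      linear_combination this
    · rintro ⟨f, hg, hf⟩
      rw [hneg] at hf
      exact ⟨⟨_, hadj f h hf, (hshift f h).2 hg⟩, hg⟩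
  · rintro f g yf sf yg sg ⟨hyf, hfyf⟩ ⟨hsf, hfsf⟩ ⟨hyg, hgyg⟩ ⟨hsg, hgsg⟩
    rw [inner_proj_eq f hyf hfyf hsf hfsf hyg hgyg, ← inner_conj_symm yf,
      inner_proj_eq g hyg hgyg hsg hgsg hyf hfyf, map_sub, map_mul, Complex.conj_ofReal,
      inner_conj_symm, inner_conj_symm, hsymm]
  · rintro f y sy ⟨hy, hfy⟩ ⟨hsy, hfsy⟩
    have key : ⟪sy, y⟫ = ⟪S f, (f : E)⟫ - ((a * ‖(f : E) - y‖ ^ 2 : ℝ) : ℂ) := by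
      rw [inner_proj_eq f hy hfy hsy hfsy hy hfy, inner_self_eq_norm_sq_to_K]
      simp
    refine ⟨key, ?_⟩
    rw [key, Complex.sub_re, Complex.ofReal_re]
    nlinarith [hpos f, sq_nonneg ‖(f : E) - y‖]
  · rintro _ ⟨f, rfl⟩
    obtain ⟨h, hh, hfh⟩ := hproj f
    obtain ⟨sh, hsh, hfsh⟩ := hproj (S f)
    refine ⟨f, h, sh, ⟨hh, hfh⟩, ⟨hsh, hfsh⟩, ?_⟩
    have := sub_proj_eq_smul_sub_proj f hh hfh hsh hfsh
    change _ = S f - (a : ℂ) • (f : E)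
    rw [sub_eq_iff_eq_add] at this
    rw [this]
    module
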